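/- Let N be a positive integer, Λ ∈ GL(N,ℝ), and let G be a smooth harmonic-Einstein map from ℝ to the symmetric positive-definite real N×N matrices such that G and G' both satisfy the Λ-holonomy boundary condition. Let h and k be smooth maps from ℝ to the symmetric real N×N matrices such that h, h', k, and k' all satisfy the Λ-holonomy boundary condition. Then ∫₀¹ ⟨(L₂h)(ξ), k(ξ)⟩_{G(ξ)} dξ = ∫₀¹ ⟨h(ξ), (L₂k)(ξ)⟩_{G(ξ)} dξ; that is, L₂ is self-adjoint with respect to the L² inner product ( φ, ψ ) = ∫₀¹ ⟨φ(ξ), ψ(ξ)⟩_{G(ξ)} dξ. -/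

import Mathlib

open Matrix

/-- The fiberwise inner product `⟨φ,ψ⟩_G = tr(G⁻¹ φ G⁻¹ ψᵀ)`. -/
noncomputable def innerG {N : ℕ} (G φ ψ : Matrix (Fin N) (Fin N) ℝ) : ℝ :=
  (G⁻¹ * φ * G⁻¹ * ψᵀ).trace

/-- The Λ-holonomy boundary condition `φ(1) = Λᵀ φ(0) Λ`. -/
def holBC {N : ℕ} (Λ : Matrix (Fin N) (Fin N) ℝ)
    (φ : ℝ → Matrix (Fin N) (Fin N) ℝ) : Prop :=
  φ 1 = Λᵀ * φ 0 * Λ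

/-- The operator `L₂` associated to a fiber metric `G` (with derivative `G'`),
acting on `h` with derivatives `h'`, `h''`. -/
noncomputable def L2 {N : ℕ} (G G' h h' h'' : ℝ → Matrix (Fin N) (Fin N) ℝ)
    (ξ : ℝ) : Matrix (Fin N) (Fin N) ℝ :=
  h'' ξ - h' ξ * (G ξ)⁻¹ * G' ξ - G' ξ * (G ξ)⁻¹ * h' ξ
    + G' ξ * (G ξ)⁻¹ * h ξ * (G ξ)⁻¹ * G' ξ

theorem Matrix.continuous_of_entries_hasDerivAt {n : Type*} {A A' : ℝ → Matrix n n ℝ}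
    (hA : ∀ t i j, HasDerivAt (fun s => A s i j) (A' t i j) t) : Continuous A :=
  continuous_matrix fun i j => continuous_iff_continuousAt.2 fun t => (hA t i j).continuousAt

/-- Entrywise smoothness makes the second derivative continuous. -/
theorem Matrix.continuous_of_second_deriv {n : Type*} {A A' A'' : ℝ → Matrix n n ℝ}
    (hA : ∀ i j, ContDiff ℝ (⊤ : ℕ∞) fun t => A t i j)
    (hA' : ∀ t i j, HasDerivAt (fun s => A s i j) (A' t i j) t)
    (hA'' : ∀ t i j, HasDerivAt (fun s => A' s i j) (A'' t i j) t) : Continuous A'' := by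
  refine continuous_matrix fun i j => ?_
  have h1 : deriv (fun s => A s i j) = fun s => A' s i j := funext fun t => (hA' t i j).deriv
  have h2 : deriv (fun s => A' s i j) = fun s => A'' s i j := funext fun t => (hA'' t i j).deriv
  have h3 := (hA i j).continuous_iteratedDeriv 2 (WithTop.coe_le_coe.2 (le_top : ((2 : ℕ) : ℕ∞) ≤ ⊤))
  rwa [iteratedDeriv_succ, iteratedDeriv_one, h1, h2] at h3

section MatrixCalculus

variable {n : Type*} [Fintype n] [DecidableEq n]

attribute [local instance] Matrix.linftyOpNormedRing Matrix.linftyOpNormedAlgebra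

theorem Matrix.hasDerivAt_of_entries {A : ℝ → Matrix n n ℝ} {A' : Matrix n n ℝ} {t : ℝ}
    (hA : ∀ i j, HasDerivAt (fun s => A s i j) (A' i j) t) : HasDerivAt A A' t := by
  have key : ∀ M : Matrix n n ℝ, M = ∑ i, ∑ j, M i j • Matrix.single i j (1 : ℝ) := by
    intro M
    conv_lhs => rw [Matrix.matrix_eq_sum_single M]
    simp
  have hsum := HasDerivAt.fun_sum (u := Finset.univ) fun i _ =>
    HasDerivAt.fun_sum (u := Finset.univ) fun j _ =>
      (hA i j).smul_const (Matrix.single i j (1 : ℝ))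
  rw [key A', funext fun s => key (A s)]
  exact hsum

theorem HasDerivAt.matrix_inv {A : ℝ → Matrix n n ℝ} {A' : Matrix n n ℝ} {t : ℝ}
    (hA : HasDerivAt A A' t) (hu : IsUnit (A t)) :
    HasDerivAt (fun s => (A s)⁻¹) (-((A t)⁻¹ * A' * (A t)⁻¹)) t := by
  obtain ⟨u, hu⟩ := hu
  have hinv : HasFDerivAt Ring.inverse
      (-ContinuousLinearMap.mulLeftRight ℝ (Matrix n n ℝ) ↑u⁻¹ ↑u⁻¹) (A t) :=
    hu ▸ hasFDerivAt_ringInverse u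
  have hfun : (fun s => (A s)⁻¹) = Ring.inverse ∘ A :=
    funext fun s => Matrix.nonsing_inv_eq_ringInverse (A s)
  rw [hfun]
  refine (hinv.comp_hasDerivAt t hA).congr_deriv ?_
  simp [← hu, Matrix.coe_units_inv]

theorem HasDerivAt.matrix_trace {A : ℝ → Matrix n n ℝ} {A' : Matrix n n ℝ} {t : ℝ}
    (hA : HasDerivAt A A' t) : HasDerivAt (fun s => (A s).trace) A'.trace t :=
  (LinearMap.toContinuousLinearMap
    (Matrix.traceLinearMap n ℝ ℝ)).hasFDerivAt.comp_hasDerivAt t hA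

end MatrixCalculus

section InnerG

variable {N : ℕ}

theorem innerG_add_left (G φ₁ φ₂ ψ : Matrix (Fin N) (Fin N) ℝ) :
    innerG G (φ₁ + φ₂) ψ = innerG G φ₁ ψ + innerG G φ₂ ψ := by
  simp [innerG, mul_add, add_mul]

theorem innerG_sub_left (G φ₁ φ₂ ψ : Matrix (Fin N) (Fin N) ℝ) :
    innerG G (φ₁ - φ₂) ψ = innerG G φ₁ ψ - innerG G φ₂ ψ := by
  simp [innerG, mul_sub, sub_mul]

theorem innerG_add_right (G φ ψ₁ ψ₂ : Matrix (Fin N) (Fin N) ℝ) :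
    innerG G φ (ψ₁ + ψ₂) = innerG G φ ψ₁ + innerG G φ ψ₂ := by
  simp [innerG, mul_add]

theorem innerG_sub_right (G φ ψ₁ ψ₂ : Matrix (Fin N) (Fin N) ℝ) :
    innerG G φ (ψ₁ - ψ₂) = innerG G φ ψ₁ - innerG G φ ψ₂ := by
  simp [innerG, mul_sub]

/-- Left multiplication by `S G⁻¹` is self-adjoint for symmetric `S` and `G`. -/
theorem innerG_mul_left_comm {G S : Matrix (Fin N) (Fin N) ℝ} (hG : G.IsSymm) (hS : S.IsSymm)
    (φ ψ : Matrix (Fin N) (Fin N) ℝ) :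
    innerG G (S * G⁻¹ * φ) ψ = innerG G φ (S * G⁻¹ * ψ) := by
  have hGi : (G⁻¹)ᵀ = G⁻¹ := by rw [Matrix.transpose_nonsing_inv, hG.eq]
  simp only [innerG, Matrix.transpose_mul, hGi, hS.eq]
  rw [show G⁻¹ * (S * G⁻¹ * φ) * G⁻¹ * ψᵀ = (G⁻¹ * S) * (G⁻¹ * φ * G⁻¹ * ψᵀ) by noncomm_ring,
    Matrix.trace_mul_comm]
  congr 1
  noncomm_ring

/-- Right multiplication by `G⁻¹ S` is self-adjoint for symmetric `S` and `G`. -/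
theorem innerG_mul_right_comm {G S : Matrix (Fin N) (Fin N) ℝ} (hG : G.IsSymm) (hS : S.IsSymm)
    (φ ψ : Matrix (Fin N) (Fin N) ℝ) :
    innerG G (φ * G⁻¹ * S) ψ = innerG G φ (ψ * G⁻¹ * S) := by
  have hGi : (G⁻¹)ᵀ = G⁻¹ := by rw [Matrix.transpose_nonsing_inv, hG.eq]
  simp only [innerG, Matrix.transpose_mul, hGi, hS.eq]
  congr 1
  noncomm_ring

/-- The fiberwise inner product is invariant under congruence. -/
theorem innerG_congruence {Λ : Matrix (Fin N) (Fin N) ℝ} (hΛ : IsUnit Λ)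
    (G φ ψ : Matrix (Fin N) (Fin N) ℝ) :
    innerG (Λᵀ * G * Λ) (Λᵀ * φ * Λ) (Λᵀ * ψ * Λ) = innerG G φ ψ := by
  have hdet : IsUnit Λ.det := (Matrix.isUnit_iff_isUnit_det Λ).1 hΛ
  have h1 : Λ * Λ⁻¹ = 1 := Matrix.mul_nonsing_inv Λ hdet
  have h2 : Λᵀ⁻¹ * Λᵀ = 1 := Matrix.nonsing_inv_mul _ (by rwa [Matrix.det_transpose])
  simp only [innerG, Matrix.mul_inv_rev, Matrix.transpose_mul, Matrix.transpose_transpose]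
  rw [show Λ⁻¹ * (G⁻¹ * Λᵀ⁻¹) * (Λᵀ * φ * Λ) * (Λ⁻¹ * (G⁻¹ * Λᵀ⁻¹)) * (Λᵀ * (ψᵀ * Λ)) =
      Λ⁻¹ * (G⁻¹ * (Λᵀ⁻¹ * Λᵀ) * φ * (Λ * Λ⁻¹) * G⁻¹ * (Λᵀ⁻¹ * Λᵀ) * ψᵀ * Λ) by noncomm_ring,
    Matrix.trace_mul_comm, h1, h2]
  simp only [mul_one, mul_assoc, h1]

theorem innerG_endpoints_eq {Λ : Matrix (Fin N) (Fin N) ℝ} (hΛ : IsUnit Λ)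
    {G φ ψ : ℝ → Matrix (Fin N) (Fin N) ℝ} (hG : holBC Λ G) (hφ : holBC Λ φ) (hψ : holBC Λ ψ) :
    innerG (G 1) (φ 1) (ψ 1) = innerG (G 0) (φ 0) (ψ 0) := by
  rw [hG, hφ, hψ, innerG_congruence hΛ]

attribute [local instance] Matrix.linftyOpNormedRing Matrix.linftyOpNormedAlgebra

theorem hasDerivAt_innerG {G φ ψ : ℝ → Matrix (Fin N) (Fin N) ℝ}
    {G' φ' ψ' : Matrix (Fin N) (Fin N) ℝ} {t : ℝ} (hu : IsUnit (G t))
    (hG : ∀ i j, HasDerivAt (fun s => G s i j) (G' i j) t)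
    (hφ : ∀ i j, HasDerivAt (fun s => φ s i j) (φ' i j) t)
    (hψ : ∀ i j, HasDerivAt (fun s => ψ s i j) (ψ' i j) t) :
    HasDerivAt (fun s => innerG (G s) (φ s) (ψ s))
      (innerG (G t) φ' (ψ t) + innerG (G t) (φ t) ψ' - innerG (G t) (G' * (G t)⁻¹ * φ t) (ψ t)
        - innerG (G t) (φ t * (G t)⁻¹ * G') (ψ t)) t := by
  have hB := (Matrix.hasDerivAt_of_entries hG).matrix_inv hu
  have hψT : HasDerivAt (fun s => (ψ s)ᵀ) ψ'ᵀ t :=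
    Matrix.hasDerivAt_of_entries fun i j => hψ j i
  have := (((hB.mul (Matrix.hasDerivAt_of_entries hφ)).mul hB).mul hψT).matrix_trace
  refine this.congr_deriv ?_
  simp only [innerG, ← Matrix.trace_add, ← Matrix.trace_sub]
  congr 1
  simp only [Pi.mul_apply]
  noncomm_ring

theorem continuous_innerG {G φ ψ : ℝ → Matrix (Fin N) (Fin N) ℝ}
    (hG : Continuous fun t => (G t)⁻¹) (hφ : Continuous φ) (hψ : Continuous ψ) :
    Continuous fun t => innerG (G t) (φ t) (ψ t) := by
  unfold innerG
  fun_prop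

end InnerG

/-- Green's identity: pointwise, `⟨L₂h, k⟩ - ⟨h, L₂k⟩ = (⟨h', k⟩ - ⟨h, k'⟩)'`. -/
theorem hasDerivAt_green_L2 {N : ℕ} {G G' h h' h'' k k' k'' : ℝ → Matrix (Fin N) (Fin N) ℝ}
    {t : ℝ} (hu : IsUnit (G t)) (hGs : (G t).IsSymm) (hG's : (G' t).IsSymm)
    (hG : ∀ i j, HasDerivAt (fun s => G s i j) (G' t i j) t)
    (hh : ∀ i j, HasDerivAt (fun s => h s i j) (h' t i j) t)
    (hh' : ∀ i j, HasDerivAt (fun s => h' s i j) (h'' t i j) t)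
    (hk : ∀ i j, HasDerivAt (fun s => k s i j) (k' t i j) t)
    (hk' : ∀ i j, HasDerivAt (fun s => k' s i j) (k'' t i j) t) :
    HasDerivAt (fun s => innerG (G s) (h' s) (k s) - innerG (G s) (h s) (k' s))
      (innerG (G t) (L2 G G' h h' h'' t) (k t) - innerG (G t) (h t) (L2 G G' k k' k'' t)) t := by
  refine ((hasDerivAt_innerG hu hG hh' hk).sub (hasDerivAt_innerG hu hG hh hk')).congr_deriv ?_
  simp only [L2, innerG_add_left, innerG_sub_left, innerG_add_right, innerG_sub_right,
    innerG_mul_right_comm hGs hG's]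
  have := innerG_mul_left_comm hGs hG's (h t) (k t * (G t)⁻¹ * G' t)
  rw [innerG_mul_left_comm hGs hG's (h t) (k' t), this]
  simp only [← mul_assoc]
  ring

theorem L2_selfAdjoint {N : ℕ} (hN : 0 < N)
    (Λ : Matrix (Fin N) (Fin N) ℝ) (hΛ : IsUnit Λ)
    (G G' G'' h h' h'' k k' k'' : ℝ → Matrix (Fin N) (Fin N) ℝ)
    (hGsmooth : ∀ i j, ContDiff ℝ (⊤ : ℕ∞) fun ξ => G ξ i j)
    (hGderiv : ∀ ξ i j, HasDerivAt (fun t => G t i j) (G' ξ i j) ξ)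
    (hGderiv2 : ∀ ξ i j, HasDerivAt (fun t => G' t i j) (G'' ξ i j) ξ)
    (hGpos : ∀ ξ, (G ξ).PosDef)
    (hHE : ∀ ξ, G'' ξ = G' ξ * (G ξ)⁻¹ * G' ξ)
    (hGbc : holBC Λ G) (hG'bc : holBC Λ G')
    (hhsmooth : ∀ i j, ContDiff ℝ (⊤ : ℕ∞) fun ξ => h ξ i j)
    (hhderiv : ∀ ξ i j, HasDerivAt (fun t => h t i j) (h' ξ i j) ξ)
    (hhderiv2 : ∀ ξ i j, HasDerivAt (fun t => h' t i j) (h'' ξ i j) ξ)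
    (hhsymm : ∀ ξ, (h ξ).IsSymm)
    (hhbc : holBC Λ h) (hh'bc : holBC Λ h')
    (hksmooth : ∀ i j, ContDiff ℝ (⊤ : ℕ∞) fun ξ => k ξ i j)
    (hkderiv : ∀ ξ i j, HasDerivAt (fun t => k t i j) (k' ξ i j) ξ)
    (hkderiv2 : ∀ ξ i j, HasDerivAt (fun t => k' t i j) (k'' ξ i j) ξ)
    (hksymm : ∀ ξ, (k ξ).IsSymm)
    (hkbc : holBC Λ k) (hk'bc : holBC Λ k') :
    (∫ ξ in (0:ℝ)..1, innerG (G ξ) (L2 G G' h h' h'' ξ) (k ξ)) =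
      ∫ ξ in (0:ℝ)..1, innerG (G ξ) (h ξ) (L2 G G' k k' k'' ξ) := by
  have hGs : ∀ ξ, (G ξ).IsSymm := fun ξ => by
    simpa [Matrix.IsSymm, Matrix.IsHermitian, Matrix.conjTranspose_eq_transpose_of_trivial] using
      (hGpos ξ).isHermitian
  have hG's : ∀ ξ, (G' ξ).IsSymm := fun ξ => Matrix.IsSymm.ext fun i j => by
    refine (hGderiv ξ j i).unique ?_
    simpa only [(hGs _).apply] using hGderiv ξ i j
  have hGc := Matrix.continuous_of_entries_hasDerivAt hGderiv
  have hG'c := Matrix.continuous_of_entries_hasDerivAt hGderiv2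
  have hhc := Matrix.continuous_of_entries_hasDerivAt hhderiv
  have hh'c := Matrix.continuous_of_entries_hasDerivAt hhderiv2
  have hh''c := Matrix.continuous_of_second_deriv hhsmooth hhderiv hhderiv2
  have hkc := Matrix.continuous_of_entries_hasDerivAt hkderiv
  have hk'c := Matrix.continuous_of_entries_hasDerivAt hkderiv2
  have hk''c := Matrix.continuous_of_second_deriv hksmooth hkderiv hkderiv2
  have hBc : Continuous fun ξ => (G ξ)⁻¹ := by
    simp only [Matrix.inv_def, Ring.inverse_eq_inv']
    exact (hGc.matrix_det.inv₀ fun ξ => (hGpos ξ).det_pos.ne').smul hGc.matrix_adjugate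
  have hLh : Continuous (L2 G G' h h' h'') := by unfold L2; fun_prop
  have hLk : Continuous (L2 G G' k k' k'') := by unfold L2; fun_prop
  have hI1 := continuous_innerG hBc hLh hkc
  have hI2 := continuous_innerG hBc hhc hLk
  rw [← sub_eq_zero, ← intervalIntegral.integral_sub (hI1.intervalIntegrable 0 1)
    (hI2.intervalIntegrable 0 1), intervalIntegral.integral_eq_sub_of_hasDerivAt
      (fun ξ _ => hasDerivAt_green_L2 (hGpos ξ).isUnit (hGs ξ) (hG's ξ) (hGderiv ξ) (hhderiv ξ)
        (hhderiv2 ξ) (hkderiv ξ) (hkderiv2 ξ)) ((hI1.sub hI2).intervalIntegrable 0 1),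
    innerG_endpoints_eq hΛ hGbc hh'bc hkbc, innerG_endpoints_eq hΛ hGbc hhbc hk'bc, sub_self]
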